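/- arXiv:0807.5058 — 2 statements merged into one kernel-verified Lean document; each statement's English description precedes it below -/
import Mathlib

section
/- Let Λ be an m×n complex matrix, π an n×n diagonal matrix with strictly positive real diagonal entries π_ii, and equip ℂ^n with the norm ‖c‖²_π = Σ_i π_ii |c_i|². Let Γ be a generalized inverse of Λ (ΛΓΛ = Λ). Then the following are equivalent: (1) πΓΛ = Λ†Γ†π (Γ is a minimum-norm g-inverse); (2) for every y in the range of Λ, x = Γy is a solution of Λx = y of minimum π-norm, i.e. ‖Γy‖_π ≤ ‖x‖_π for every x with Λx = y. -/
open Matrix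

open scoped ComplexOrder

namespace Matrix

variable {n : Type*} [Fintype n] [DecidableEq n]

/-- An idempotent matrix `P` is self-adjoint for the form of a positive semidefinite matrix `D`
iff it is contractive for that form. -/
theorem PosSemidef.mul_eq_conjTranspose_mul_iff_of_isIdempotentElem {D P : Matrix n n ℂ}
    (hD : D.PosSemidef) (hP : IsIdempotentElem P) :
    D * P = Pᴴ * D ↔ (D - Pᴴ * D * P).PosSemidef := by
  have hPP : P * P = P := hP
  constructor
  · intro h
    have key : D - Pᴴ * D * P = (1 - P)ᴴ * D * (1 - P) := by
      have h1 : Pᴴ * D * P = D * P := by rw [← h, mul_assoc, hPP]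
      rw [conjTranspose_sub, conjTranspose_one, sub_mul, mul_sub, sub_mul, one_mul, mul_one,
        mul_one, sub_mul, h1, ← h]
      abel
    rw [key]
    exact hD.conjTranspose_mul_mul_same _
  · intro h
    have hzero : Pᴴ * ((D - Pᴴ * D * P) * P) = 0 := by
      have hPP' : Pᴴ * Pᴴ = Pᴴ := by rw [← conjTranspose_mul, hPP]
      rw [sub_mul, mul_sub, mul_assoc _ P P, hPP, ← mul_assoc, ← mul_assoc, ← mul_assoc, hPP',
        sub_self]
    have hMP : (D - Pᴴ * D * P) * P = 0 := by
      refine ext_of_mulVec_single fun i => ?_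
      rw [← mulVec_mulVec, zero_mulVec, ← h.dotProduct_mulVec_zero_iff, star_mulVec,
        ← dotProduct_mulVec, mulVec_mulVec, mulVec_mulVec, mul_assoc, hzero, zero_mulVec, dotProduct_zero]
    have hDP : D * P = Pᴴ * D * P := by
      rwa [sub_mul, mul_assoc _ P P, hPP, sub_eq_zero] at hMP
    have hherm : (Pᴴ * D * P).IsHermitian := isHermitian_conjTranspose_mul_mul P hD.isHermitian
    rw [← hDP, IsHermitian, conjTranspose_mul, hD.isHermitian.eq] at hherm
    exact hherm.symm

theorem star_dotProduct_diagonal_ofReal_mulVec (p : n → ℝ) (x : n → ℂ) :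
    star x ⬝ᵥ diagonal (fun i => (p i : ℂ)) *ᵥ x = ((∑ i, p i * ‖x i‖ ^ 2 : ℝ) : ℂ) := by
  simp only [dotProduct, mulVec_diagonal, Pi.star_apply, Complex.ofReal_sum, Complex.ofReal_mul,
    Complex.ofReal_pow, ← Complex.conj_mul', RCLike.star_def]
  exact Finset.sum_congr rfl fun i _ => by ring

theorem posSemidef_diagonal_sub_conjTranspose_mul_mul_iff (p : n → ℝ) (P : Matrix n n ℂ) :
    (diagonal (fun i => (p i : ℂ)) - Pᴴ * diagonal (fun i => (p i : ℂ)) * P).PosSemidef ↔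
      ∀ x : n → ℂ, ∑ i, p i * ‖(P *ᵥ x) i‖ ^ 2 ≤ ∑ i, p i * ‖x i‖ ^ 2 := by
  have hD : (diagonal (fun i => (p i : ℂ))).IsHermitian :=
    isHermitian_diagonal_of_self_adjoint _ (by ext i; simp)
  have hM := hD.sub (isHermitian_conjTranspose_mul_mul P hD)
  rw [posSemidef_iff_dotProduct_mulVec, and_iff_right hM]
  refine forall_congr' fun x => ?_
  rw [sub_mulVec, dotProduct_sub, ← mulVec_mulVec, ← mulVec_mulVec, dotProduct_mulVec _ Pᴴ,
    ← star_mulVec, star_dotProduct_diagonal_ofReal_mulVec,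
    star_dotProduct_diagonal_ofReal_mulVec, sub_nonneg, Complex.real_le_real]

end Matrix

/-- for a g-inverse Γ of Λ and a diagonal weight matrix π with
strictly positive real diagonal entries, the minimum-norm condition
πΓΛ = Λ†Γ†π holds iff for every y in the range of Λ, x = Γy is a minimum
π-norm solution of Λx = y. -/
theorem min_norm_ginverse_iff {m n : ℕ}
    (Λ : Matrix (Fin m) (Fin n) ℂ) (Γ : Matrix (Fin n) (Fin m) ℂ)
    (hΓ : Λ * Γ * Λ = Λ)
    (p : Fin n → ℝ) (hp : ∀ i, 0 < p i) :
    (Matrix.diagonal (fun i => (p i : ℂ)) * (Γ * Λ) =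
        Λᴴ * Γᴴ * Matrix.diagonal (fun i => (p i : ℂ))) ↔
      ∀ y : Fin m → ℂ, (∃ u : Fin n → ℂ, Λ.mulVec u = y) →
        ∀ x : Fin n → ℂ, Λ.mulVec x = y →
          ∑ i, p i * ‖Γ.mulVec y i‖ ^ 2 ≤ ∑ i, p i * ‖x i‖ ^ 2 := by
  have hP : IsIdempotentElem (Γ * Λ) := by
    rw [IsIdempotentElem, Matrix.mul_assoc, ← Matrix.mul_assoc Λ, hΓ]
  have hD : (diagonal fun i => (p i : ℂ)).PosSemidef :=
    PosSemidef.diagonal fun i => Complex.zero_le_real.2 (hp i).le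
  rw [← conjTranspose_mul, hD.mul_eq_conjTranspose_mul_iff_of_isIdempotentElem hP,
    posSemidef_diagonal_sub_conjTranspose_mul_mul_iff]
  constructor
  · rintro h y - x rfl
    simpa only [mulVec_mulVec] using h x
  · intro h x
    simpa only [mulVec_mulVec] using h (Λ *ᵥ x) ⟨x, rfl⟩ x rfl
end

section
/- Let Λ be an m×n complex matrix and Γ_mp a matrix satisfying the Moore–Penrose conditions Γ_mpΛΓ_mp = Γ_mp, ΛΓ_mpΛ = Λ, (Γ_mpΛ)† = Γ_mpΛ, (ΛΓ_mp)† = ΛΓ_mp; set M := Γ_mpΛ. Let π be an n×n diagonal matrix with strictly positive real diagonal entries, A := (I − M)π(I − M), and let B satisfy the Penrose conditions ABA = A, BAB = B, (AB)† = AB, (BA)† = BA. Then Γ_opt := Γ_mp − BπMΓ_mp satisfies the minimum-norm condition πΓ_optΛ = Λ†Γ_opt†π. -/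
open Matrix

section

open scoped ComplexOrder

/-- If `D` is positive definite and `P` is Hermitian, then `P * D * P` is injective on matrices
fixed by `P`. -/
theorem Matrix.PosDef.eq_zero_of_compression_mul_eq_zero {n : Type*} [Fintype n]
    {D P R : Matrix n n ℂ} (hD : D.PosDef) (hP : P.IsHermitian)
    (hR : P * R = R) (h : P * D * P * R = 0) : R = 0 := by
  have hRP : Rᴴ * P = Rᴴ := by
    conv_rhs => rw [← hR, conjTranspose_mul, hP.eq]
  have hz : Rᴴ * D * R = 0 := by
    calc Rᴴ * D * R = Rᴴ * P * D * (P * R) := by rw [hRP, hR]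
      _ = Rᴴ * (P * D * P * R) := by simp only [Matrix.mul_assoc]
      _ = 0 := by rw [h, Matrix.mul_zero]
  classical
  refine Matrix.ext_of_mulVec_single fun j => ?_
  rw [Matrix.zero_mulVec]
  by_contra hne
  have hpos := hD.dotProduct_mulVec_pos hne
  rw [star_mulVec, ← dotProduct_mulVec, mulVec_mulVec, mulVec_mulVec, hz,
    zero_mulVec, dotProduct_zero] at hpos
  exact lt_irrefl _ hpos

/-- The Moore–Penrose inverse `B` of the compression `P * D * P` of a positive definite matrix
to the range of an orthogonal projection `P` is Hermitian, is fixed by right multiplication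
by `P`, and satisfies `B * (P * D * P) = P`. -/
theorem Matrix.PosDef.compression_pinv {n : Type*} [Fintype n]
    {D P A B : Matrix n n ℂ} (hD : D.PosDef) (hP : P.IsHermitian) (hPP : P * P = P)
    (hA : P * D * P = A) (hABA : A * B * A = A) (hBAB : B * A * B = B)
    (hAB : (A * B)ᴴ = A * B) (hBA : (B * A)ᴴ = B * A) :
    B.IsHermitian ∧ B * P = B ∧ B * A = P := by
  have hAP : A * P = A := by rw [← hA, Matrix.mul_assoc, hPP]
  have hPA : P * A = A := by rw [← hA, ← Matrix.mul_assoc, ← Matrix.mul_assoc, hPP]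
  have hAh : Aᴴ = A := by
    rw [← hA, conjTranspose_mul, conjTranspose_mul, hP.eq, hD.isHermitian.eq, Matrix.mul_assoc]
  have hAB' : Bᴴ * A = A * B := by rw [← hAB, conjTranspose_mul, hAh]
  have hBA' : A * Bᴴ = B * A := by rw [← hBA, conjTranspose_mul, hAh]
  have hBP : B * P = B := by
    have hB : B = B * (Bᴴ * A) := by rw [hAB', ← Matrix.mul_assoc, hBAB]
    calc B * P = B * (Bᴴ * A) * P := by rw [← hB]
      _ = B * (Bᴴ * (A * P)) := by simp only [Matrix.mul_assoc]
      _ = B := by rw [hAP, ← hB]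
  have hPB : P * B = B := by
    have hB : B = A * Bᴴ * B := by rw [hBA', hBAB]
    calc P * B = P * (A * Bᴴ * B) := by rw [← hB]
      _ = P * A * Bᴴ * B := by simp only [Matrix.mul_assoc]
      _ = B := by rw [hPA, ← hB]
  have hBA_eq : B * A = P := by
    refine (sub_eq_zero.mp (hD.eq_zero_of_compression_mul_eq_zero hP (R := P - B * A) ?_ ?_)).symm
    · rw [Matrix.mul_sub, hPP, ← Matrix.mul_assoc, hPB]
    · rw [hA, Matrix.mul_sub, hAP, ← Matrix.mul_assoc, hABA, sub_self]
  have hAB_eq : A * B = P := by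
    refine (sub_eq_zero.mp (hD.eq_zero_of_compression_mul_eq_zero hP (R := P - A * B) ?_ ?_)).symm
    · rw [Matrix.mul_sub, hPP, ← Matrix.mul_assoc, hPA]
    · have h : A * (A * B) = A := by
        have hc : (A * B * A)ᴴ = Aᴴ := by rw [hABA]
        rwa [conjTranspose_mul, hAB, hAh] at hc
      rw [hA, Matrix.mul_sub, hAP, h, sub_self]
  refine ⟨?_, hBP, hBA_eq⟩
  have hBhP : Bᴴ * P = Bᴴ := by
    conv_rhs => rw [← hPB, conjTranspose_mul, hP.eq]
  calc Bᴴ = Bᴴ * (A * B) := by rw [hAB_eq, hBhP]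
    _ = B := by rw [← Matrix.mul_assoc, hAB', hAB_eq, hPB]

end

/-- Γ_opt := Γ_mp − BπMΓ_mp satisfies the minimum-norm condition πΓ_optΛ = Λ†Γ_opt†π,
where M = Γ_mpΛ and B is the Moore–Penrose inverse of A = (I − M)π(I − M). -/
theorem gamma_opt_min_norm {m n : ℕ}
    (Λ : Matrix (Fin m) (Fin n) ℂ) (Γmp : Matrix (Fin n) (Fin m) ℂ)
    (h1 : Γmp * Λ * Γmp = Γmp)
    (h2 : Λ * Γmp * Λ = Λ)
    (h3 : (Γmp * Λ)ᴴ = Γmp * Λ)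
    (h4 : (Λ * Γmp)ᴴ = Λ * Γmp)
    (p : Fin n → ℝ) (hp : ∀ i, 0 < p i)
    (B : Matrix (Fin n) (Fin n) ℂ)
    (hABA : (((1 : Matrix (Fin n) (Fin n) ℂ) - Γmp * Λ) *
        Matrix.diagonal (fun i => (p i : ℂ)) *
        ((1 : Matrix (Fin n) (Fin n) ℂ) - Γmp * Λ)) * B *
        (((1 : Matrix (Fin n) (Fin n) ℂ) - Γmp * Λ) *
        Matrix.diagonal (fun i => (p i : ℂ)) *
        ((1 : Matrix (Fin n) (Fin n) ℂ) - Γmp * Λ)) =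
      ((1 : Matrix (Fin n) (Fin n) ℂ) - Γmp * Λ) *
        Matrix.diagonal (fun i => (p i : ℂ)) *
        ((1 : Matrix (Fin n) (Fin n) ℂ) - Γmp * Λ))
    (hBAB : B * (((1 : Matrix (Fin n) (Fin n) ℂ) - Γmp * Λ) *
        Matrix.diagonal (fun i => (p i : ℂ)) *
        ((1 : Matrix (Fin n) (Fin n) ℂ) - Γmp * Λ)) * B = B)
    (hAB : ((((1 : Matrix (Fin n) (Fin n) ℂ) - Γmp * Λ) *
        Matrix.diagonal (fun i => (p i : ℂ)) *
        ((1 : Matrix (Fin n) (Fin n) ℂ) - Γmp * Λ)) * B)ᴴ =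
      (((1 : Matrix (Fin n) (Fin n) ℂ) - Γmp * Λ) *
        Matrix.diagonal (fun i => (p i : ℂ)) *
        ((1 : Matrix (Fin n) (Fin n) ℂ) - Γmp * Λ)) * B)
    (hBA : (B * (((1 : Matrix (Fin n) (Fin n) ℂ) - Γmp * Λ) *
        Matrix.diagonal (fun i => (p i : ℂ)) *
        ((1 : Matrix (Fin n) (Fin n) ℂ) - Γmp * Λ)))ᴴ =
      B * (((1 : Matrix (Fin n) (Fin n) ℂ) - Γmp * Λ) *
        Matrix.diagonal (fun i => (p i : ℂ)) *
        ((1 : Matrix (Fin n) (Fin n) ℂ) - Γmp * Λ))) :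
    Matrix.diagonal (fun i => (p i : ℂ)) *
        ((Γmp - B * Matrix.diagonal (fun i => (p i : ℂ)) * (Γmp * Λ) * Γmp) * Λ) =
      Λᴴ * (Γmp - B * Matrix.diagonal (fun i => (p i : ℂ)) * (Γmp * Λ) * Γmp)ᴴ *
        Matrix.diagonal (fun i => (p i : ℂ)) := by
  set D : Matrix (Fin n) (Fin n) ℂ := Matrix.diagonal (fun i => (p i : ℂ)) with hDdef
  set P : Matrix (Fin n) (Fin n) ℂ := 1 - Γmp * Λ with hPdef
  open scoped ComplexOrder in
  have hD : D.PosDef := Matrix.PosDef.diagonal fun i => by exact_mod_cast hp i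
  have hMM : Γmp * Λ * (Γmp * Λ) = Γmp * Λ := by rw [← Matrix.mul_assoc, h1]
  have hP : P.IsHermitian := by
    rw [Matrix.IsHermitian, hPdef, conjTranspose_sub, conjTranspose_one, h3]
  have hPP : P * P = P := by
    rw [hPdef, Matrix.mul_sub, Matrix.sub_mul, Matrix.sub_mul, hMM]
    simp
  obtain ⟨hB, hBP, hBA_eq⟩ := hD.compression_pinv hP hPP rfl hABA hBAB hAB hBA
  have hBDP : B * D * P = P := by
    rwa [← Matrix.mul_assoc, ← Matrix.mul_assoc, hBP] at hBA_eq
  have hM : Γmp * Λ = 1 - P := by rw [hPdef, sub_sub_cancel]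
  have key : (Γmp - B * D * (Γmp * Λ) * Γmp) * Λ = 1 - B * D := by
    rw [Matrix.sub_mul, Matrix.mul_assoc _ Γmp Λ, Matrix.mul_assoc _ (Γmp * Λ), hMM, hM,
      Matrix.mul_sub, hBDP, Matrix.mul_one]
    abel
  rw [← conjTranspose_mul, key, conjTranspose_sub, conjTranspose_one, conjTranspose_mul, hB.eq,
    hD.isHermitian.eq, Matrix.mul_sub, Matrix.sub_mul, Matrix.mul_one, Matrix.one_mul,
    Matrix.mul_assoc]
end
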